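/- Let q ≥ 2 be an even integer with 3 ∤ (q+1), and let x be an integer with 1 ≤ x ≤ q. Then x occurs in exactly (q−2)/2 triples of T. -/

import Mathlib

open Finset

/-- The set of triples `(k,l,m)` of integers with `1 ≤ k < l < m ≤ q+1` and
`k + l + m ≡ 0 (mod q+1)`. -/
def T (q : ℕ) : Finset (ℕ × ℕ × ℕ) :=
  (Finset.Icc 1 (q+1) ×ˢ Finset.Icc 1 (q+1) ×ˢ Finset.Icc 1 (q+1)).filter
    (fun t => t.1 < t.2.1 ∧ t.2.1 < t.2.2 ∧ (q+1) ∣ (t.1 + t.2.1 + t.2.2))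

/-- The number of triples of `T q` in which the integer `x` occurs. -/
def occ (q x : ℕ) : ℕ :=
  ((T q).filter (fun t => t.1 = x ∨ t.2.1 = x ∨ t.2.2 = x)).card

theorem dvd_iff_eq_or_eq_two_mul {n s : ℕ} (hpos : 0 < s) (hlt : s < 3 * n) :
    n ∣ s ↔ s = n ∨ s = 2 * n := by
  constructor
  · rintro ⟨c, rfl⟩
    have hc : c < 3 := by
      by_contra! h
      nlinarith [Nat.mul_le_mul_left n h]
    interval_cases c <;> omega
  · rintro (h | h)
    · exact ⟨1, by omega⟩
    · exact ⟨2, by omega⟩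

theorem mem_T_iff {q k l m : ℕ} :
    (k, l, m) ∈ T q ↔
      1 ≤ k ∧ k < l ∧ l < m ∧ m ≤ q + 1 ∧
        (k + l + m = q + 1 ∨ k + l + m = 2 * (q + 1)) := by
  simp only [T, mem_filter, mem_product, mem_Icc]
  constructor
  · rintro ⟨h, hkl, hlm, hd⟩
    rw [dvd_iff_eq_or_eq_two_mul (by omega) (by omega)] at hd
    omega
  · rintro ⟨hk, hkl, hlm, hm, hd⟩
    rw [dvd_iff_eq_or_eq_two_mul (by omega) (by omega)]
    omega

/-- The possible smaller elements of a pair completing `x` to a triple of `T q`. -/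
def smallerPartners (q x : ℕ) : Finset ℕ :=
  (Icc 1 ((q - x) / 2) ∪ Icc (q + 1 - x) ((2 * q + 1 - x) / 2)).erase
    (min x (if 2 * x ≤ q then q + 1 - 2 * x else 2 * (q + 1) - 2 * x))

theorem mem_smallerPartners_iff {q x y : ℕ} :
    y ∈ smallerPartners q x ↔
      y ≠ min x (if 2 * x ≤ q then q + 1 - 2 * x else 2 * (q + 1) - 2 * x) ∧
        (1 ≤ y ∧ y ≤ (q - x) / 2 ∨ q + 1 - x ≤ y ∧ y ≤ (2 * q + 1 - x) / 2) := by
  simp only [smallerPartners, mem_erase, mem_union, mem_Icc]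

theorem card_smallerPartners {q x : ℕ} (heven : Even q) (h3 : ¬ (3 ∣ (q + 1)))
    (hx1 : 1 ≤ x) (hxq : x ≤ q) : (smallerPartners q x).card = (q - 2) / 2 := by
  obtain ⟨r, rfl⟩ := heven
  rw [smallerPartners, card_erase_of_mem, card_union_of_disjoint, Nat.card_Icc, Nat.card_Icc]
  · omega
  · rw [disjoint_left]
    intro y
    simp only [mem_Icc]
    omega
  · simp only [mem_union, mem_Icc]
    split_ifs <;> omega

theorem occ_eq_card_smallerPartners {q x : ℕ} (heven : Even q) (h3 : ¬ (3 ∣ (q + 1)))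
    (hx1 : 1 ≤ x) (hxq : x ≤ q) : occ q x = (smallerPartners q x).card := by
  obtain ⟨r, rfl⟩ := heven
  refine card_bij (fun t _ => if t.1 = x then t.2.1 else t.1) ?_ ?_ ?_
  · rintro ⟨k, l, m⟩ h
    rw [mem_filter, mem_T_iff] at h
    rw [mem_smallerPartners_iff]
    dsimp only at h ⊢
    split_ifs <;> omega
  · rintro ⟨k, l, m⟩ h ⟨k', l', m'⟩ h' heq
    rw [mem_filter, mem_T_iff] at h h'
    dsimp only at h h' heq
    rw [Prod.mk.injEq, Prod.mk.injEq]
    split_ifs at heq <;> omega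
  · intro y hy
    rw [mem_smallerPartners_iff] at hy
    obtain ⟨z, hyz, hz, hyx, hzx, hsum⟩ : ∃ z, y < z ∧ z ≤ r + r + 1 ∧ y ≠ x ∧ z ≠ x ∧
        (x + y + z = r + r + 1 ∨ x + y + z = 2 * (r + r + 1)) := by
      rcases hy with ⟨hne, h | h⟩
      · refine ⟨r + r + 1 - x - y, ?_⟩
        split_ifs at hne <;> omega
      · refine ⟨2 * (r + r + 1) - x - y, ?_⟩
        split_ifs at hne <;> omega
    have hy1 : 1 ≤ y := by omega
    rcases lt_or_gt_of_ne hyx with hlt | hgt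
    · rcases lt_or_gt_of_ne hzx with hlt' | hgt'
      · refine ⟨(y, z, x), ?_, if_neg hyx⟩
        rw [mem_filter, mem_T_iff]
        dsimp only
        omega
      · refine ⟨(y, x, z), ?_, if_neg hyx⟩
        rw [mem_filter, mem_T_iff]
        dsimp only
        omega
    · refine ⟨(x, y, z), ?_, if_pos rfl⟩
      rw [mem_filter, mem_T_iff]
      dsimp only
      omega

theorem stmt_6 (q : ℕ) (hq : 2 ≤ q) (heven : Even q) (h3 : ¬ (3 ∣ (q+1)))
    (x : ℕ) (hx1 : 1 ≤ x) (hxq : x ≤ q) :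
    occ q x = (q - 2) / 2 := by
  rw [occ_eq_card_smallerPartners heven h3 hx1 hxq, card_smallerPartners heven h3 hx1 hxq]
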